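/- Let m ≠ 0, v_0 ≥ 0, let k ≥ 1 be an integer, let η ∈ (0,1) with kη² ≤ 2, and set T := kη. Define μ_1 = e^{−T} m, σ_1² = e^{−2T} v_0 + (1 − e^{−2T})/2, μ_2 = (1−η)^k m, and σ_2² = (1−η)^{2k} v_0 + (1 − (1−η)^{2k})/(2 − η). If moreover σ_2² ≤ 2σ_1², then D_KL( N(μ_1,σ_1²) || N(μ_2,σ_2²) ) ≥ ( m² e^{−2T} T² / (64 σ_1²) ) · η². -/

import Mathlib

open MeasureTheory ProbabilityTheory

/-- The Kullback–Leibler divergence `D_KL(μ‖ν) = ∫ log(dμ/dν) dμ`. -/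
noncomputable def klDivergence (μ ν : Measure ℝ) : ℝ :=
  ∫ x, Real.log (μ.rnDeriv ν x).toReal ∂μ

lemma log_gaussianPDFReal (m : ℝ) {v : NNReal} (hv : v ≠ 0) (x : ℝ) :
    Real.log (gaussianPDFReal m v x)
      = -(Real.log (2 * Real.pi * v) / 2) - (x - m) ^ 2 / (2 * v) := by
  have hv' : (0 : ℝ) < v := by positivity
  have h : (0 : ℝ) < 2 * Real.pi * v := by positivity
  rw [gaussianPDFReal_def, Real.log_mul (by positivity) (Real.exp_pos _).ne', Real.log_exp,
    Real.log_inv, Real.log_sqrt h.le]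
  ring

lemma log_rnDeriv_gaussianReal_ae_eq (m₁ m₂ : ℝ) {v₁ v₂ : NNReal} (h₁ : v₁ ≠ 0) (h₂ : v₂ ≠ 0) :
    ∀ᵐ x ∂(gaussianReal m₁ v₁),
      Real.log ((gaussianReal m₁ v₁).rnDeriv (gaussianReal m₂ v₂) x).toReal
        = Real.log (gaussianPDFReal m₁ v₁ x) - Real.log (gaussianPDFReal m₂ v₂ x) := by
  have hac : gaussianReal m₁ v₁ ≪ gaussianReal m₂ v₂ :=
    (gaussianReal_absolutelyContinuous m₁ h₁).trans (gaussianReal_absolutelyContinuous' m₂ h₂)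
  filter_upwards [gaussianReal_absolutelyContinuous m₁ h₁
      (Measure.rnDeriv_mul_rnDeriv (κ := volume) hac),
    gaussianReal_absolutelyContinuous m₁ h₁ (rnDeriv_gaussianReal m₁ v₁),
    gaussianReal_absolutelyContinuous m₁ h₁ (rnDeriv_gaussianReal m₂ v₂)] with x hx hx₁ hx₂
  have h := congrArg ENNReal.toReal hx
  rw [Pi.mul_apply, hx₁, hx₂, ENNReal.toReal_mul, toReal_gaussianPDF, toReal_gaussianPDF] at h
  have p₁ := gaussianPDFReal_pos m₁ v₁ x h₁
  have p₂ := gaussianPDFReal_pos m₂ v₂ x h₂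
  rw [← Real.log_div p₁.ne' p₂.ne', ← h, mul_div_cancel_right₀ _ p₂.ne']

lemma integrable_sub_sq_gaussianReal (m a : ℝ) (v : NNReal) :
    Integrable (fun x ↦ (x - a) ^ 2) (gaussianReal m v) :=
  ((memLp_id_gaussianReal 2).sub (memLp_const a)).integrable_sq

lemma integral_sub_sq_gaussianReal (m a : ℝ) (v : NNReal) :
    ∫ x, (x - a) ^ 2 ∂(gaussianReal m v) = v + (m - a) ^ 2 := by
  have h := variance_eq_sub (μ := gaussianReal m v) (X := fun x ↦ x - a)
    ((memLp_id_gaussianReal 2).sub (memLp_const a))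
  rw [variance_sub_const (by fun_prop), variance_fun_id_gaussianReal,
    integral_sub (by exact (memLp_id_gaussianReal 1).integrable le_rfl) (integrable_const a),
    integral_id_gaussianReal, integral_const, probReal_univ, one_smul] at h
  simp only [Pi.pow_apply] at h
  linarith

lemma klDivergence_gaussianReal (m₁ m₂ : ℝ) {v₁ v₂ : NNReal} (h₁ : v₁ ≠ 0) (h₂ : v₂ ≠ 0) :
    klDivergence (gaussianReal m₁ v₁) (gaussianReal m₂ v₂)
      = (Real.log (v₂ / v₁) + v₁ / v₂ - 1 + (m₁ - m₂) ^ 2 / v₂) / 2 := by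
  have hv₁ : (0 : ℝ) < v₁ := by positivity
  have hv₂ : (0 : ℝ) < v₂ := by positivity
  have i₁ := (integrable_sub_sq_gaussianReal m₁ m₁ v₁).div_const (2 * (v₁ : ℝ))
  have i₂ := (integrable_sub_sq_gaussianReal m₁ m₂ v₁).div_const (2 * (v₂ : ℝ))
  rw [klDivergence, integral_congr_ae (log_rnDeriv_gaussianReal_ae_eq m₁ m₂ h₁ h₂)]
  simp_rw [log_gaussianPDFReal _ h₁, log_gaussianPDFReal _ h₂]
  rw [integral_sub (by exact (integrable_const _).sub i₁) (by exact (integrable_const _).sub i₂),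
    integral_sub (integrable_const _) i₁, integral_sub (integrable_const _) i₂,
    integral_div, integral_div, integral_sub_sq_gaussianReal, integral_sub_sq_gaussianReal,
    Real.log_mul (by positivity) hv₁.ne', Real.log_mul (by positivity) hv₂.ne',
    Real.log_div hv₂.ne' hv₁.ne']
  simp only [integral_const, probReal_univ, one_smul]
  field_simp
  ring

lemma sq_sub_div_le_klDivergence_gaussianReal (m₁ m₂ : ℝ) {v₁ v₂ : NNReal}
    (h₁ : v₁ ≠ 0) (h₂ : v₂ ≠ 0) :
    (m₁ - m₂) ^ 2 / (2 * v₂) ≤ klDivergence (gaussianReal m₁ v₁) (gaussianReal m₂ v₂) := by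
  have h := Real.one_sub_inv_le_log_of_pos (x := (v₂ : ℝ) / v₁) (by positivity)
  rw [inv_div] at h
  rw [klDivergence_gaussianReal m₁ m₂ h₁ h₂, mul_comm, ← div_div]
  linarith

lemma one_sub_le_exp_neg_sub_sq_div_two {x : ℝ} (h0 : 0 ≤ x) (h1 : x < 1) :
    1 - x ≤ Real.exp (-x - x ^ 2 / 2) := by
  have hs := Real.hasSum_pow_div_log_of_abs_lt_one (abs_lt.2 ⟨by linarith, h1⟩)
  have h := sum_le_hasSum (Finset.range 2) (fun i _ ↦ by positivity) hs
  norm_num [Finset.sum_range_succ] at h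
  rw [← Real.log_le_iff_le_exp (by linarith)]
  linarith

lemma half_le_one_sub_exp_neg {x : ℝ} (h0 : 0 ≤ x) (h1 : x ≤ 1) :
    x / 2 ≤ 1 - Real.exp (-x) := by
  have h : Real.exp (-x) ≤ (1 + x)⁻¹ := by
    rw [Real.exp_neg]
    exact inv_anti₀ (by positivity) (by linarith [Real.add_one_le_exp x])
  have h' : (1 + x)⁻¹ ≤ 1 - x / 2 := by
    rw [inv_le_iff_one_le_mul₀ (by positivity)]
    nlinarith
  linarith

lemma exp_neg_mul_le_exp_neg_sub_one_sub_pow {η : ℝ} {k : ℕ} (h0 : 0 ≤ η) (h1 : η < 1)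
    (hk : (k : ℝ) * η ^ 2 ≤ 2) :
    Real.exp (-(k * η)) * (k * η * η / 4) ≤ Real.exp (-(k * η)) - (1 - η) ^ k := by
  have hpow : (1 - η) ^ k ≤ Real.exp (-(k * η)) * Real.exp (-(k * η ^ 2 / 2)) := by
    calc (1 - η) ^ k ≤ Real.exp (-η - η ^ 2 / 2) ^ k :=
          pow_le_pow_left₀ (by linarith) (one_sub_le_exp_neg_sub_sq_div_two h0 h1) k
      _ = _ := by rw [← Real.exp_nat_mul, ← Real.exp_add]; ring_nf
  have h := half_le_one_sub_exp_neg (x := k * η ^ 2 / 2) (by positivity) (by linarith)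
  nlinarith [mul_le_mul_of_nonneg_left h (Real.exp_pos (-(k * η))).le]

/-- **Sharpness of the O(η²) KL bound** (Section 5.2). Comparing the time-`T`
law `N(μ₁,σ₁²)` of the OU process started from `N(m, v₀)` with the law
`N(μ₂,σ₂²)` of its `k`-step Euler–Maruyama discretization with step `η`
(`T = kη`), the KL divergence is at least `(m² e^{−2T} T² / (64 σ₁²)) η²`. -/
theorem ou_euler_kl_lower_bound
    (m v0 η T μ1 μ2 σ1sq σ2sq : ℝ) (k : ℕ)
    (hm : m ≠ 0) (hv0 : 0 ≤ v0) (hk : 1 ≤ k)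
    (hη0 : 0 < η) (hη1 : η < 1) (hkη : (k : ℝ) * η ^ 2 ≤ 2)
    (hT : T = k * η)
    (hμ1 : μ1 = Real.exp (-T) * m)
    (hσ1 : σ1sq = Real.exp (-2 * T) * v0 + (1 - Real.exp (-2 * T)) / 2)
    (hμ2 : μ2 = (1 - η) ^ k * m)
    (hσ2 : σ2sq = (1 - η) ^ (2 * k) * v0 + (1 - (1 - η) ^ (2 * k)) / (2 - η))
    (hvarcmp : σ2sq ≤ 2 * σ1sq) :
    (m ^ 2 * Real.exp (-2 * T) * T ^ 2 / (64 * σ1sq)) * η ^ 2 ≤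
      klDivergence (gaussianReal μ1 σ1sq.toNNReal)
        (gaussianReal μ2 σ2sq.toNNReal) := by
  have hk0 : (0 : ℝ) < k := by exact_mod_cast hk
  have hT0 : 0 < T := hT ▸ mul_pos hk0 hη0
  have hv1 : 0 < σ1sq := by
    have : Real.exp (-2 * T) < 1 := Real.exp_lt_one_iff.2 (by linarith)
    have : 0 ≤ Real.exp (-2 * T) * v0 := by positivity
    linarith
  have hv2 : 0 < σ2sq := by
    have hpow : (1 - η) ^ (2 * k) < 1 := pow_lt_one₀ (by linarith) (by linarith) (by omega)
    have hdiv : 0 < (1 - (1 - η) ^ (2 * k)) / (2 - η) := div_pos (by linarith) (by linarith)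
    have : 0 ≤ (1 - η) ^ (2 * k) * v0 := mul_nonneg ((even_two_mul k).pow_nonneg _) hv0
    linarith
  have hkl := sq_sub_div_le_klDivergence_gaussianReal μ1 μ2
    (Real.toNNReal_pos.2 hv1).ne' (Real.toNNReal_pos.2 hv2).ne'
  rw [Real.coe_toNNReal _ hv2.le] at hkl
  refine le_trans ?_ hkl
  have hgap := exp_neg_mul_le_exp_neg_sub_one_sub_pow hη0.le hη1 hkη
  rw [← hT] at hgap
  have hsq : m ^ 2 * (Real.exp (-T) * (T * η / 4)) ^ 2 ≤ (μ1 - μ2) ^ 2 := by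
    rw [hμ1, hμ2, ← sub_mul, mul_pow _ m, mul_comm (_ ^ 2) (m ^ 2)]
    gcongr
  have hexp : Real.exp (-2 * T) = Real.exp (-T) ^ 2 := by
    rw [← Real.exp_nat_mul]; ring_nf
  calc (m ^ 2 * Real.exp (-2 * T) * T ^ 2 / (64 * σ1sq)) * η ^ 2
      = m ^ 2 * (Real.exp (-T) * (T * η / 4)) ^ 2 / (2 * (2 * σ1sq)) := by
        rw [hexp]; field_simp; ring
    _ ≤ (μ1 - μ2) ^ 2 / (2 * σ2sq) := by gcongr
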